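/- arXiv:2502.16659 — 7 statements merged into one kernel-verified Lean document; each statement's English description precedes it below -/
import Mathlib

section
/- Fix positive integers B and L, a subset F ⊆ {1,…,B}, nonnegative reals d_{b,ℓ} for 1 ≤ b ≤ B and 1 ≤ ℓ ≤ L, and nonnegative reals G_b for 1 ≤ b ≤ B. For ε ≥ 0 let V(ε) be the supremum, over α ∈ ℝ^B and β ∈ ℝ^L with α_b ≥ ε for all b, β_ℓ ≥ ε for all ℓ, and Σ_b α_b + Σ_ℓ β_ℓ = 1, of min_{1≤b≤B} [ Σ_{ℓ=1}^L β_ℓ·d_{b,ℓ} + α_b·G_b·1{b ∈ F} ]. Then for every ε with 0 < ε < 1/(B+L): V(ε) ≤ V(0) and V(0) − V(ε) ≤ ε·(B+L)·V(0); equivalently, whenever V(0) > 0, one has 0 ≤ 1 − V(ε)/V(0) ≤ ε·(B+L). -/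
open Filter

/-- The objective values attained by sampling ratios that are all at least `e`. -/
def feasibleValues {B L : ℕ} (hB : 0 < B) (F : Finset (Fin B)) (d : Fin B → Fin L → ℝ)
    (G : Fin B → ℝ) (e : ℝ) : Set ℝ :=
  {v : ℝ | ∃ α : Fin B → ℝ, ∃ β : Fin L → ℝ,
      (∀ b, e ≤ α b) ∧ (∀ ℓ, e ≤ β ℓ) ∧ ((∑ b, α b) + (∑ ℓ, β ℓ) = 1) ∧
      v = Finset.univ.inf' (Finset.univ_nonempty_iff.mpr (Fin.pos_iff_nonempty.mp hB))
        (fun b => (∑ ℓ, β ℓ * d b ℓ) + α b * G b * (if b ∈ F then 1 else 0))}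

section feasibleValues

variable {B L : ℕ} (hB : 0 < B) (F : Finset (Fin B)) {d : Fin B → Fin L → ℝ} {G : Fin B → ℝ}

theorem feasibleValues_antitone (d : Fin B → Fin L → ℝ) (G : Fin B → ℝ) :
    Antitone (feasibleValues hB F d G) := by
  rintro e e' hee v ⟨α, β, hα, hβ, h⟩
  exact ⟨α, β, fun b => hee.trans (hα b), fun ℓ => hee.trans (hβ ℓ), h⟩

theorem feasibleValues_nonempty (d : Fin B → Fin L → ℝ) (G : Fin B → ℝ) {e : ℝ}
    (he : e ≤ 1 / ((B : ℝ) + L)) : (feasibleValues hB F d G e).Nonempty := by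
  have hBpos : (0 : ℝ) < B := by exact_mod_cast hB
  refine ⟨_, fun _ => 1 / ((B : ℝ) + L), fun _ => 1 / ((B : ℝ) + L),
    fun _ => he, fun _ => he, ?_, rfl⟩
  simp only [Finset.sum_const, Finset.card_univ, Fintype.card_fin, nsmul_eq_mul]
  field_simp

theorem feasibleValues_zero_bddAbove (hd : ∀ b ℓ, 0 ≤ d b ℓ) (hG : ∀ b, 0 ≤ G b) :
    BddAbove (feasibleValues hB F d G 0) := by
  refine ⟨(∑ ℓ, d ⟨0, hB⟩ ℓ) + G ⟨0, hB⟩, ?_⟩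
  rintro v ⟨α, β, hα, hβ, hsum, rfl⟩
  refine (Finset.inf'_le _ (Finset.mem_univ ⟨0, hB⟩)).trans ?_
  have hα1 : α ⟨0, hB⟩ ≤ 1 := by
    have h1 := Finset.single_le_sum (fun b _ => hα b) (Finset.mem_univ ⟨0, hB⟩)
    have h2 := Finset.sum_nonneg (fun ℓ (_ : ℓ ∈ Finset.univ) => hβ ℓ)
    linarith
  have hβ1 : ∀ ℓ, β ℓ ≤ 1 := fun ℓ => by
    have h1 := Finset.single_le_sum (fun ℓ _ => hβ ℓ) (Finset.mem_univ ℓ)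
    have h2 := Finset.sum_nonneg (fun b (_ : b ∈ Finset.univ) => hα b)
    linarith
  refine add_le_add (Finset.sum_le_sum fun ℓ _ => mul_le_of_le_one_left (hd _ _) (hβ1 ℓ)) ?_
  exact (mul_le_of_le_one_right (mul_nonneg (hα _) (hG _)) (by split_ifs <;> norm_num)).trans
    (mul_le_of_le_one_left (hG _) hα1)

/-- Mixing unconstrained ratios with the constant `ε` yields feasible ratios and loses at most the
factor `1 - ε * (B + L)`. -/
theorem exists_feasibleValues_ge_mul (hd : ∀ b ℓ, 0 ≤ d b ℓ) (hG : ∀ b, 0 ≤ G b) {ε v : ℝ}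
    (hε : 0 ≤ ε) (hc : 0 ≤ 1 - ε * ((B : ℝ) + L)) (hv : v ∈ feasibleValues hB F d G 0) :
    ∃ w ∈ feasibleValues hB F d G ε, v * (1 - ε * ((B : ℝ) + L)) ≤ w := by
  obtain ⟨α, β, hα, hβ, hsum, rfl⟩ := hv
  set c : ℝ := 1 - ε * ((B : ℝ) + L) with hcdef
  refine ⟨_, ⟨fun b => ε + c * α b, fun ℓ => ε + c * β ℓ,
    fun b => le_add_of_nonneg_right (mul_nonneg hc (hα b)),
    fun ℓ => le_add_of_nonneg_right (mul_nonneg hc (hβ ℓ)), ?_, rfl⟩, ?_⟩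
  · simp only [Finset.sum_add_distrib, ← Finset.mul_sum, Finset.sum_const, Finset.card_univ,
      Fintype.card_fin, nsmul_eq_mul]
    linear_combination c * hsum + hcdef
  · refine Finset.le_inf' _ _ fun b hb => ?_
    refine (mul_le_mul_of_nonneg_right (Finset.inf'_le _ hb) hc).trans ?_
    rw [add_mul, Finset.sum_mul]
    refine add_le_add (Finset.sum_le_sum fun ℓ _ => ?_) ?_
    · have := mul_nonneg hε (hd b ℓ)
      linarith
    · have hind : (0 : ℝ) ≤ if b ∈ F then 1 else 0 := by split_ifs <;> norm_num
      have := mul_nonneg (mul_nonneg hε (hG b)) hind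
      linarith

end feasibleValues

/-- Proposition 2: the optimality gap of the ε-constrained asymptotic
budget-allocation program satisfies `V(ε) ≤ V(0)` and
`V(0) − V(ε) ≤ ε (B+L) V(0)` for `0 < ε < 1/(B+L)`. -/
theorem stmt2 (B L : ℕ) (hB : 0 < B) (hL : 0 < L)
    (F : Finset (Fin B))
    (d : Fin B → Fin L → ℝ) (hd : ∀ b ℓ, 0 ≤ d b ℓ)
    (G : Fin B → ℝ) (hG : ∀ b, 0 ≤ G b)
    (V : ℝ → ℝ)
    (hV : ∀ e : ℝ, V e = sSup {v : ℝ | ∃ α : Fin B → ℝ, ∃ β : Fin L → ℝ,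
      (∀ b, e ≤ α b) ∧ (∀ ℓ, e ≤ β ℓ) ∧ ((∑ b, α b) + (∑ ℓ, β ℓ) = 1) ∧
      v = Finset.univ.inf' (Finset.univ_nonempty_iff.mpr (Fin.pos_iff_nonempty.mp hB))
        (fun b => (∑ ℓ, β ℓ * d b ℓ) + α b * G b * (if b ∈ F then 1 else 0))}) :
    ∀ ε : ℝ, 0 < ε → ε < 1 / ((B : ℝ) + (L : ℝ)) →
      V ε ≤ V 0 ∧ V 0 - V ε ≤ ε * ((B : ℝ) + (L : ℝ)) * V 0 := by
  intro ε hε hεn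
  have hV' : ∀ e, V e = sSup (feasibleValues hB F d G e) := hV
  have hBpos : (0 : ℝ) < B := by exact_mod_cast hB
  have hn : (0 : ℝ) < (B : ℝ) + L := by positivity
  have hc : 0 < 1 - ε * ((B : ℝ) + L) := sub_pos.mpr ((lt_div_iff₀ hn).mp hεn)
  have hbdd := feasibleValues_zero_bddAbove hB F hd hG
  have hsub := feasibleValues_antitone hB F d G hε.le
  refine ⟨?_, ?_⟩
  · rw [hV' ε, hV' 0]
    exact csSup_le_csSup hbdd (feasibleValues_nonempty hB F d G hεn.le) hsub
  · have key : V 0 ≤ V ε / (1 - ε * ((B : ℝ) + L)) := by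
      rw [hV' 0]
      refine csSup_le (feasibleValues_nonempty hB F d G (by positivity)) fun v hv => ?_
      obtain ⟨w, hw, hvw⟩ := exists_feasibleValues_ge_mul hB F hd hG hε.le hc.le hv
      rw [le_div_iff₀ hc, hV' ε]
      exact hvw.trans (le_csSup (hbdd.mono hsub) hw)
    rw [le_div_iff₀ hc] at key
    linarith
end

section
/- Fix positive integers B and L, a subset F ⊆ {1,…,B}, nonnegative reals d_{b,ℓ} for 1 ≤ b ≤ B and 1 ≤ ℓ ≤ L, nonnegative reals G_b for 1 ≤ b ≤ B, and a distinguished index b₀ ∈ F with d_{b₀,ℓ} = 0 for every ℓ. Assume G_b > 0 for every b ∈ F and that for every b ∉ F there exists ℓ with d_{b,ℓ} > 0. Consider the program: maximize, over α ∈ ℝ^B and β ∈ ℝ^L with α ≥ 0, β ≥ 0, and Σ_b α_b + Σ_ℓ β_ℓ = 1, the objective min_{1≤b≤B} [ Σ_{ℓ=1}^L β_ℓ·d_{b,ℓ} + α_b·G_b·1{b ∈ F} ]. Then every maximizer (α*, β*) satisfies α*_b = 0 for every b ∉ F and α*_{b₀} > 0. -/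
open Filter

/-- Corollary 1: every maximizer of the asymptotic budget-allocation program
assigns zero simulation ratio to every parameter in the adversarial set of the
optimum (`b ∉ F`), and a strictly positive simulation ratio to the true
parameter `b₀`. -/
theorem stmt3 (B L : ℕ) (hB : 0 < B) (hL : 0 < L)
    (F : Finset (Fin B)) (b₀ : Fin B) (hb₀F : b₀ ∈ F)
    (d : Fin B → Fin L → ℝ) (hd : ∀ b ℓ, 0 ≤ d b ℓ)
    (hd0 : ∀ ℓ, d b₀ ℓ = 0)
    (G : Fin B → ℝ) (hG : ∀ b, 0 ≤ G b)
    (hGF : ∀ b ∈ F, 0 < G b)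
    (hdF : ∀ b ∉ F, ∃ ℓ, 0 < d b ℓ)
    (α : Fin B → ℝ) (β : Fin L → ℝ)
    (hα : ∀ b, 0 ≤ α b) (hβ : ∀ ℓ, 0 ≤ β ℓ)
    (hsum : (∑ b, α b) + (∑ ℓ, β ℓ) = 1)
    (hopt : ∀ (α' : Fin B → ℝ) (β' : Fin L → ℝ),
      (∀ b, 0 ≤ α' b) → (∀ ℓ, 0 ≤ β' ℓ) → (∑ b, α' b) + (∑ ℓ, β' ℓ) = 1 →
      Finset.univ.inf' (Finset.univ_nonempty_iff.mpr (Fin.pos_iff_nonempty.mp hB))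
          (fun b => (∑ ℓ, β' ℓ * d b ℓ) + α' b * G b * (if b ∈ F then 1 else 0)) ≤
        Finset.univ.inf' (Finset.univ_nonempty_iff.mpr (Fin.pos_iff_nonempty.mp hB))
          (fun b => (∑ ℓ, β ℓ * d b ℓ) + α b * G b * (if b ∈ F then 1 else 0))) :
    (∀ b ∉ F, α b = 0) ∧ 0 < α b₀ := by
  have hne : (Finset.univ : Finset (Fin B)).Nonempty := ⟨b₀, Finset.mem_univ _⟩
  set obj : (Fin B → ℝ) → (Fin L → ℝ) → Fin B → ℝ := fun a e b =>
    (∑ ℓ, e ℓ * d b ℓ) + a b * G b * (if b ∈ F then 1 else 0) with hobj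
  set V := Finset.univ.inf' hne (obj α β) with hV
  have hVle : ∀ b, V ≤ obj α β b := fun b => Finset.inf'_le _ (Finset.mem_univ b)
  have hVpos : 0 < V := by
    have hN : (0 : ℝ) < B + L := by positivity
    refine lt_of_lt_of_le ?_ (hopt (fun _ => 1 / (B + L)) (fun _ => 1 / (B + L))
      (fun _ => by positivity) (fun _ => by positivity) ?_)
    · rw [Finset.lt_inf'_iff]
      intro b _
      have hs : 0 ≤ ∑ ℓ, 1 / ((B : ℝ) + L) * d b ℓ :=
        Finset.sum_nonneg fun ℓ _ => mul_nonneg (by positivity) (hd b ℓ)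
      by_cases hb : b ∈ F
      · have := mul_pos (one_div_pos.mpr hN) (hGF b hb)
        simp only [hb, if_true, mul_one]
        linarith
      · obtain ⟨ℓ, hℓ⟩ := hdF b hb
        simp only [hb, if_false, mul_zero, add_zero]
        exact Finset.sum_pos' (fun ℓ _ => mul_nonneg (by positivity) (hd b ℓ))
          ⟨ℓ, Finset.mem_univ _, mul_pos (one_div_pos.mpr hN) hℓ⟩
    · simp only [Finset.sum_const, Finset.card_univ, Fintype.card_fin, nsmul_eq_mul]
      field_simp
  have hα₀ : 0 < α b₀ := by
    have h := hVpos.trans_le (hVle b₀)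
    simp only [hobj, hd0, mul_zero, Finset.sum_const_zero, zero_add, hb₀F, if_true,
      mul_one] at h
    exact pos_of_mul_pos_left h (hG b₀)
  refine ⟨fun b hb => ?_, hα₀⟩
  by_contra hne0
  have hbpos : 0 < α b := lt_of_le_of_ne (hα b) (Ne.symm hne0)
  -- Redistribute the budget spent outside `F` by rescaling the rest.
  set a : Fin B → ℝ := fun i => if i ∈ F then α i else 0 with ha
  have ha0 : ∀ i, 0 ≤ a i := fun i => by
    simp only [ha]; split_ifs <;> simp [hα]
  set s := (∑ i, a i) + ∑ ℓ, β ℓ with hs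
  have hs1 : s < 1 := by
    have : ∑ i, a i < ∑ i, α i := by
      refine Finset.sum_lt_sum (fun i _ => ?_) ⟨b, Finset.mem_univ _, by simpa [ha, hb]⟩
      simp only [ha]; split_ifs <;> simp [hα]
    linarith
  have hs0 : 0 < s := by
    have h1 : 0 < ∑ i, a i := Finset.sum_pos' (fun i _ => ha0 i)
      ⟨b₀, Finset.mem_univ _, by simpa [ha, hb₀F]⟩
    have h2 : 0 ≤ ∑ ℓ, β ℓ := Finset.sum_nonneg fun ℓ _ => hβ ℓ
    linarith
  have hscale : ∀ i, obj (fun i => a i / s) (fun ℓ => β ℓ / s) i = obj α β i / s := fun i => by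
    simp only [hobj, ha, add_div, Finset.sum_div]
    congr 1
    · exact Finset.sum_congr rfl fun ℓ _ => by ring
    · split_ifs <;> ring
  have hle : V / s ≤ V := by
    refine le_trans ?_ (hopt (fun i => a i / s) (fun ℓ => β ℓ / s)
      (fun i => div_nonneg (ha0 i) hs0.le) (fun ℓ => div_nonneg (hβ ℓ) hs0.le) ?_)
    · refine Finset.le_inf' _ _ fun i _ => ?_
      exact (div_le_div_of_nonneg_right (hVle i) hs0.le).trans_eq (hscale i).symm
    · rw [← Finset.sum_div, ← Finset.sum_div, ← add_div, ← hs, div_self hs0.ne']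
  rw [div_le_iff₀ hs0] at hle
  nlinarith
end

section
/- Let M be a real m×n matrix, Σ a symmetric positive definite real n×n matrix, K a symmetric positive semidefinite real m×m matrix, κ > 0 a real number, and x ∈ ℝⁿ. Set A = M·Σ⁻¹·Mᵀ + κ·K and b = M·Σ⁻¹·x, and define g : ℝ^m → ℝ by g(c) = (1/2)·(x − Mᵀc)ᵀ·Σ⁻¹·(x − Mᵀc) + (κ/2)·cᵀ·K·c. Then there exists c* ∈ ℝ^m with A·c* = b, and every c* satisfying A·c* = b is a global minimizer of g, i.e., g(c*) ≤ g(c) for all c ∈ ℝ^m. -/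
open Matrix

namespace Matrix

/-- The Fredholm alternative: `b` is in the range of `A` if it is orthogonal to the left kernel. -/
theorem exists_mulVec_eq_of_forall_dotProduct_eq_zero {ι κ F : Type*} [Fintype ι] [Fintype κ]
    [Field F] (A : Matrix ι κ F) (b : ι → F)
    (h : ∀ v : ι → F, v ᵥ* A = 0 → v ⬝ᵥ b = 0) : ∃ c : κ → F, A *ᵥ c = b := by
  classical
  by_contra hb
  obtain ⟨f, hfb, hf⟩ := Submodule.exists_le_ker_of_notMem (p := LinearMap.range A.mulVecLin)
    (v := b) (by simpa using hb)
  obtain ⟨v, rfl⟩ := (dotProductEquiv F ι).surjective f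
  refine hfb (h v (dotProduct_eq_zero _ fun w => ?_))
  rw [← dotProduct_mulVec]
  exact hf ⟨w, rfl⟩

/-- A symmetric matrix can be moved across the dot product. -/
theorem IsSymm.dotProduct_mulVec_comm {ι R : Type*} [Fintype ι] [CommSemiring R]
    {P : Matrix ι ι R} (hP : P.IsSymm) (u v : ι → R) : u ⬝ᵥ P *ᵥ v = v ⬝ᵥ P *ᵥ u := by
  rw [dotProduct_mulVec, ← mulVec_transpose, hP.eq, dotProduct_comm]

/-- Expansion of the quadratic form of a symmetric matrix at a sum. -/
theorem IsSymm.dotProduct_mulVec_add_self {ι R : Type*} [Fintype ι] [CommSemiring R]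
    {P : Matrix ι ι R} (hP : P.IsSymm) (u v : ι → R) :
    (u + v) ⬝ᵥ P *ᵥ (u + v) = u ⬝ᵥ P *ᵥ u + 2 * (v ⬝ᵥ P *ᵥ u) + v ⬝ᵥ P *ᵥ v := by
  rw [mulVec_add, dotProduct_add, add_dotProduct, add_dotProduct, hP.dotProduct_mulVec_comm u v]
  ring

/-- The bilinear form of a regularized normal matrix. -/
theorem dotProduct_mul_mul_transpose_add_smul_mulVec {ι κ R : Type*} [Fintype ι] [Fintype κ]
    [CommSemiring R] (M : Matrix ι κ R) (P : Matrix κ κ R) (K : Matrix ι ι R) (a : R)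
    (u v : ι → R) :
    u ⬝ᵥ (M * P * Mᵀ + a • K) *ᵥ v = (Mᵀ *ᵥ u) ⬝ᵥ P *ᵥ (Mᵀ *ᵥ v) + a * (u ⬝ᵥ K *ᵥ v) := by
  rw [add_mulVec, dotProduct_add, smul_mulVec, dotProduct_smul, smul_eq_mul, ← mulVec_mulVec,
    ← mulVec_mulVec, dotProduct_mulVec u M, ← mulVec_transpose]

end Matrix

/-- Proposition 3 (core): the normal equations `A c = b` with
`A = M Σ⁻¹ Mᵀ + κ K` and `b = M Σ⁻¹ x` are solvable, and any solution is a
global minimizer of the regularized Gaussian negative log-likelihood objective. -/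
theorem stmt5 (m n : ℕ)
    (M : Matrix (Fin m) (Fin n) ℝ)
    (S : Matrix (Fin n) (Fin n) ℝ) (hS_symm : S.IsSymm) (hS : S.PosDef)
    (K : Matrix (Fin m) (Fin m) ℝ) (hK_symm : K.IsSymm) (hK : K.PosSemidef)
    (κ : ℝ) (hκ : 0 < κ) (x : Fin n → ℝ) :
    (∃ c : Fin m → ℝ,
      (M * S⁻¹ * Mᵀ + κ • K).mulVec c = M.mulVec (S⁻¹.mulVec x)) ∧
    (∀ c : Fin m → ℝ,
      (M * S⁻¹ * Mᵀ + κ • K).mulVec c = M.mulVec (S⁻¹.mulVec x) →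
      ∀ c' : Fin m → ℝ,
        (1 / 2) * ((x - Mᵀ.mulVec c) ⬝ᵥ S⁻¹.mulVec (x - Mᵀ.mulVec c)) +
            (κ / 2) * (c ⬝ᵥ K.mulVec c) ≤
          (1 / 2) * ((x - Mᵀ.mulVec c') ⬝ᵥ S⁻¹.mulVec (x - Mᵀ.mulVec c')) +
            (κ / 2) * (c' ⬝ᵥ K.mulVec c')) := by
  have hP : S⁻¹.PosDef := hS.inv
  have hP_symm : S⁻¹.IsSymm := by
    rw [Matrix.IsSymm, transpose_nonsing_inv, hS_symm.eq]
  have hK_nonneg (v : Fin m → ℝ) : 0 ≤ v ⬝ᵥ K *ᵥ v := by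
    simpa using hK.dotProduct_mulVec_nonneg v
  have hP_nonneg (v : Fin n → ℝ) : 0 ≤ v ⬝ᵥ S⁻¹ *ᵥ v := by
    simpa using hP.posSemidef.dotProduct_mulVec_nonneg v
  have hb (v : Fin m → ℝ) : v ⬝ᵥ M *ᵥ (S⁻¹ *ᵥ x) = (Mᵀ *ᵥ v) ⬝ᵥ S⁻¹ *ᵥ x := by
    rw [dotProduct_mulVec v M, ← mulVec_transpose]
  refine ⟨exists_mulVec_eq_of_forall_dotProduct_eq_zero _ _ fun v hv => ?_, fun c hc c' => ?_⟩
  · have hA := dotProduct_mul_mul_transpose_add_smul_mulVec M S⁻¹ K κ v v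
    rw [dotProduct_mulVec v (M * S⁻¹ * Mᵀ + κ • K), hv, zero_dotProduct] at hA
    have hMv : Mᵀ *ᵥ v = 0 := by
      by_contra hne
      have hpos : 0 < (Mᵀ *ᵥ v) ⬝ᵥ S⁻¹ *ᵥ (Mᵀ *ᵥ v) := by
        simpa using hP.dotProduct_mulVec_pos hne
      linarith [mul_nonneg hκ.le (hK_nonneg v)]
    rw [hb, hMv, zero_dotProduct]
  · obtain ⟨d, rfl⟩ : ∃ d, c' = c + d := ⟨c' - c, by abel⟩
    have hr : x - Mᵀ *ᵥ (c + d) = (x - Mᵀ *ᵥ c) + -(Mᵀ *ᵥ d) := by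
      rw [mulVec_add]; abel
    have hA := dotProduct_mul_mul_transpose_add_smul_mulVec M S⁻¹ K κ d c
    rw [hc, hb] at hA
    have hlin : (Mᵀ *ᵥ d) ⬝ᵥ S⁻¹ *ᵥ (x - Mᵀ *ᵥ c) = κ * (d ⬝ᵥ K *ᵥ c) := by
      rw [mulVec_sub, dotProduct_sub, hA]; ring
    rw [hr, hP_symm.dotProduct_mulVec_add_self, hK_symm.dotProduct_mulVec_add_self,
      neg_dotProduct, hlin]
    linarith [hP_nonneg (-(Mᵀ *ᵥ d)), mul_nonneg hκ.le (hK_nonneg d)]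
end

section
/- Let Θ be a finite set, let F ⊆ Θ with F ≠ Θ, let θ₀ ∈ F, and let D : Θ → ℝ and G : Θ → ℝ with G(θ) ≥ 0 for all θ. Then the minimum, over all subsets S with θ₀ ∈ S ⊆ F, of [ min_{θ ∈ Θ∖S} D(θ) + Σ_{θ ∈ F∖S} G(θ) ] equals min( min_{θ ∈ Θ∖F} D(θ), min_{θ ∈ F∖{θ₀}} (D(θ) + G(θ)) ), where the second inner minimum is omitted (treated as +∞) when F = {θ₀}. (Note that Θ∖S ⊇ Θ∖F ≠ ∅ for every such S, so all minima on the left are over nonempty sets.) -/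
open Finset

theorem Finset.exists_mem_csInf_image_eq {α : Type*} (f : α → ℝ) {s : Finset α}
    (hs : s.Nonempty) : ∃ x ∈ s, sInf (f '' (s : Set α)) = f x := by
  obtain ⟨x, hx, hfx⟩ :=
    (hs.to_set.image f).csInf_mem (s.finite_toSet.image f)
  exact ⟨x, hx, hfx.symm⟩

theorem Finset.csInf_image_le {α : Type*} (f : α → ℝ) {s : Finset α} {x : α}
    (hx : x ∈ s) : sInf (f '' (s : Set α)) ≤ f x :=
  csInf_le (s.finite_toSet.image f).bddBelow ⟨x, hx, rfl⟩

/-- Steps 3–4 of the proof of Theorem 2: the minimum over all estimated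
favorable sets `S` with `θ₀ ∈ S ⊆ F` of
`min_{Θ∖S} D + Σ_{F∖S} G` equals
`min( min_{Θ∖F} D , min_{θ ∈ F∖{θ₀}} (D θ + G θ) )`, the second inner minimum
being omitted when `F = {θ₀}`. -/
theorem stmt7 (Θ : Type*) [Fintype Θ] [DecidableEq Θ]
    (F : Finset Θ) (hF : F ≠ Finset.univ) (θ₀ : Θ) (hθ₀ : θ₀ ∈ F)
    (D G : Θ → ℝ) (hG : ∀ θ, 0 ≤ G θ) :
    sInf {v : ℝ | ∃ S : Finset Θ, θ₀ ∈ S ∧ S ⊆ F ∧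
        v = sInf (D '' ((Finset.univ \ S : Finset Θ) : Set Θ)) + ∑ θ ∈ F \ S, G θ} =
      if F = {θ₀} then sInf (D '' ((Finset.univ \ F : Finset Θ) : Set Θ))
      else
        min (sInf (D '' ((Finset.univ \ F : Finset Θ) : Set Θ)))
          (sInf ((fun θ => D θ + G θ) '' ((F \ {θ₀} : Finset Θ) : Set Θ))) := by
  set V : Set ℝ := {v : ℝ | ∃ S : Finset Θ, θ₀ ∈ S ∧ S ⊆ F ∧
    v = sInf (D '' ((Finset.univ \ S : Finset Θ) : Set Θ)) + ∑ θ ∈ F \ S, G θ}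
  have hbdd : BddBelow V := by
    refine ((Set.finite_range fun S : Finset Θ =>
      sInf (D '' ((Finset.univ \ S : Finset Θ) : Set Θ)) + ∑ θ ∈ F \ S, G θ).subset ?_).bddBelow
    rintro v ⟨S, -, -, rfl⟩
    exact ⟨S, rfl⟩
  have hFV : sInf (D '' ((Finset.univ \ F : Finset Θ) : Set Θ)) ∈ V :=
    ⟨F, hθ₀, Finset.Subset.refl F, by simp only [sdiff_self, Finset.bot_eq_empty, Finset.sum_empty, add_zero]⟩
  have hF_le : sInf V ≤ sInf (D '' ((Finset.univ \ F : Finset Θ) : Set Θ)) := csInf_le hbdd hFV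
  have hle : ∀ θ ∈ F \ {θ₀}, sInf V ≤ D θ + G θ := by
    intro θ hθ
    obtain ⟨hθF, hne⟩ : θ ∈ F ∧ θ ≠ θ₀ := by simpa using hθ
    have hmem : sInf (D '' ((Finset.univ \ F.erase θ : Finset Θ) : Set Θ)) +
        ∑ η ∈ F \ F.erase θ, G η ∈ V :=
      ⟨F.erase θ, by simp [hθ₀, hne.symm], Finset.erase_subset θ F, rfl⟩
    refine (csInf_le hbdd hmem).trans (add_le_add ?_ ?_)
    · exact Finset.csInf_image_le D (by simp)
    · rw [Finset.sdiff_erase_self hθF, Finset.sum_singleton]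
  have hge : ∀ r : ℝ, r ≤ sInf (D '' ((Finset.univ \ F : Finset Θ) : Set Θ)) →
      (∀ θ ∈ F \ {θ₀}, r ≤ D θ + G θ) → r ≤ sInf V := by
    intro r hr hr'
    refine le_csInf ⟨_, hFV⟩ ?_
    rintro v ⟨S, hS₀, hSF, rfl⟩
    have hSne : (Finset.univ \ S).Nonempty := by
      rw [Finset.sdiff_nonempty]
      exact fun h => hF (Finset.univ_subset_iff.mp (h.trans hSF))
    obtain ⟨x, hx, hxD⟩ := Finset.exists_mem_csInf_image_eq D hSne
    have hxS : x ∉ S := by simpa using hx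
    rw [hxD]
    by_cases hxF : x ∈ F
    · refine (hr' x ?_).trans (add_le_add le_rfl ?_)
      · simp only [Finset.mem_sdiff, Finset.mem_singleton]
        exact ⟨hxF, fun h => hxS (h ▸ hS₀)⟩
      · exact Finset.single_le_sum (fun η _ => hG η) (Finset.mem_sdiff.mpr ⟨hxF, hxS⟩)
    · exact (hr.trans (Finset.csInf_image_le D (by simpa using hxF))).trans
        (le_add_of_nonneg_right (Finset.sum_nonneg fun η _ => hG η))
  split_ifs with h
  · refine le_antisymm hF_le (hge _ le_rfl ?_)
    intro θ hθ
    simp [h] at hθ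
  · refine le_antisymm (le_min hF_le ?_) (hge _ (min_le_left _ _) fun θ hθ =>
      (min_le_right _ _).trans (Finset.csInf_image_le (fun θ => D θ + G θ) hθ))
    have hne : (F \ {θ₀}).Nonempty := by
      rw [Finset.sdiff_nonempty]
      exact fun hs => h (Finset.Subset.antisymm hs (Finset.singleton_subset_iff.mpr hθ₀))
    obtain ⟨x, hx, hxD⟩ := Finset.exists_mem_csInf_image_eq (fun θ => D θ + G θ) hne
    rw [hxD]
    exact hle x hx
end

section
/- Let Θ ⊂ ℝ^d be a compact set with nonempty interior, let I : ℝ^d → ℝ be continuous and nonnegative with I(θ₀) = 0 for some θ₀ in the interior of Θ, and for each T > 0 let ρ_T : Θ → (0,∞) be a measurable function such that sup_{θ∈Θ} |(1/T)·log ρ_T(θ) + I(θ)| → 0 as T → ∞. Let S ⊆ Θ be Lebesgue-measurable with nonempty interior and with inf_{θ∈int(S)} I(θ) = inf_{θ∈S} I(θ). Then −(1/T)·log ( ∫_S ρ_T(θ) dθ / ∫_Θ ρ_T(θ) dθ ) → inf_{θ∈S} I(θ) as T → ∞, with integrals taken with respect to d-dimensional Lebesgue measure. -/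
open Filter MeasureTheory

/-- Laplace principle: if `(1/T) log (ρ T)` converges to `-I` uniformly on a set `A` of finite
measure on which the infimum of `I` is already approached in the interior, then `∫ θ in A, ρ T θ`
is eventually positive and decays at the exponential rate `inf_A I`. -/
theorem eventually_integral_pos_and_tendsto_log_integral {X : Type*} [TopologicalSpace X]
    [MeasurableSpace X] [OpensMeasurableSpace X] (μ : Measure X) [μ.IsOpenPosMeasure]
    {A : Set X} (hA : MeasurableSet A) (hμA : μ A ≠ ⊤) (hAint : (interior A).Nonempty)
    {I : X → ℝ} (hI : Continuous I) (hI0 : BddBelow (I '' A))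
    (hinf : sInf (I '' interior A) = sInf (I '' A))
    {ρ : ℝ → X → ℝ} (hpos : ∀ T : ℝ, 0 < T → ∀ θ ∈ A, 0 < ρ T θ)
    (hmeas : ∀ T : ℝ, 0 < T → Measurable (ρ T))
    (hunif : ∀ ε : ℝ, 0 < ε → ∀ᶠ T : ℝ in atTop,
      ∀ θ ∈ A, |(1 / T) * Real.log (ρ T θ) + I θ| < ε) :
    (∀ᶠ T : ℝ in atTop, 0 < ∫ θ in A, ρ T θ ∂μ) ∧
      Tendsto (fun T : ℝ => (1 / T) * Real.log (∫ θ in A, ρ T θ ∂μ)) atTop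
        (nhds (-sInf (I '' A))) := by
  set m := sInf (I '' A)
  have hmI : ∀ θ ∈ A, m ≤ I θ := fun θ hθ => csInf_le hI0 (Set.mem_image_of_mem I hθ)
  have hVpos : 0 < μ.real A := ENNReal.toReal_pos
    ((isOpen_interior.measure_pos μ hAint).trans_le (measure_mono interior_subset)).ne' hμA
  have bounds : ∀ δ : ℝ, 0 < δ → ∃ v : ℝ, 0 < v ∧ ∀ᶠ T : ℝ in atTop,
      v * Real.exp (T * (-m - 2 * δ)) ≤ ∫ θ in A, ρ T θ ∂μ ∧
      ∫ θ in A, ρ T θ ∂μ ≤ μ.real A * Real.exp (T * (-m + δ)) := by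
    intro δ hδ
    set U := interior A ∩ I ⁻¹' Set.Iio (m + δ)
    have hUopen : IsOpen U := isOpen_interior.inter (isOpen_Iio.preimage hI)
    have hUA : U ⊆ A := fun x hx => interior_subset hx.1
    have hUne : U.Nonempty := by
      obtain ⟨_, ⟨θ, hθ, rfl⟩, hlt⟩ :=
        exists_lt_of_csInf_lt (hAint.image I) (show sInf (I '' interior A) < m + δ by linarith)
      exact ⟨θ, hθ, hlt⟩
    have hμU : μ U ≠ ⊤ := measure_ne_top_of_subset hUA hμA
    refine ⟨μ.real U, ENNReal.toReal_pos (hUopen.measure_pos μ hUne).ne' hμU, ?_⟩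
    filter_upwards [hunif δ hδ, eventually_gt_atTop 0] with T hT hT0
    have hlog : ∀ θ ∈ A, T * (-I θ - δ) < Real.log (ρ T θ) ∧
        Real.log (ρ T θ) < T * (-I θ + δ) := by
      intro θ hθ
      obtain ⟨h1, h2⟩ := abs_lt.1 (hT θ hθ)
      have hl : Real.log (ρ T θ) = T * ((1 / T) * Real.log (ρ T θ)) := by field_simp
      rw [hl]
      exact ⟨mul_lt_mul_of_pos_left (by linarith) hT0, mul_lt_mul_of_pos_left (by linarith) hT0⟩
    have hupper : ∀ θ ∈ A, ‖ρ T θ‖ ≤ Real.exp (T * (-m + δ)) := by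
      intro θ hθ
      rw [Real.norm_of_nonneg (hpos T hT0 θ hθ).le, ← Real.log_le_iff_le_exp (hpos T hT0 θ hθ)]
      exact (hlog θ hθ).2.le.trans
        (mul_le_mul_of_nonneg_left (by linarith [hmI θ hθ]) hT0.le)
    have hlower : ∀ θ ∈ U, Real.exp (T * (-m - 2 * δ)) ≤ ρ T θ := by
      intro θ hθ
      have hlt : I θ < m + δ := hθ.2
      rw [← Real.le_log_iff_exp_le (hpos T hT0 θ (hUA hθ))]
      exact (mul_le_mul_of_nonneg_left (by linarith) hT0.le).trans (hlog θ (hUA hθ)).1.le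
    have hint : IntegrableOn (ρ T) A μ :=
      Measure.integrableOn_of_bounded hμA (hmeas T hT0).aestronglyMeasurable
        ((ae_restrict_iff' hA).2 (ae_of_all _ hupper))
    constructor
    · calc μ.real U * Real.exp (T * (-m - 2 * δ))
          = ∫ _ in U, Real.exp (T * (-m - 2 * δ)) ∂μ := by simp
        _ ≤ ∫ θ in U, ρ T θ ∂μ :=
          setIntegral_mono_on (integrableOn_const hμU) (hint.mono_set hUA)
            hUopen.measurableSet hlower
        _ ≤ ∫ θ in A, ρ T θ ∂μ :=
          setIntegral_mono_set hint
            ((ae_restrict_iff' hA).2 (ae_of_all _ fun θ hθ => (hpos T hT0 θ hθ).le))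
            hUA.eventuallyLE
    · rw [mul_comm]
      exact (Real.le_norm_self _).trans
        (norm_setIntegral_le_of_norm_le_const hμA.lt_top hupper)
  constructor
  · obtain ⟨v, hv, h⟩ := bounds 1 one_pos
    filter_upwards [h] with T hT
    exact (by positivity : 0 < v * Real.exp (T * (-m - 2 * 1))).trans_le hT.1
  · have hsmall : ∀ c δ : ℝ, 0 < δ → ∀ᶠ T : ℝ in atTop, |c / T| < δ := fun c δ hδ => by
      simpa [abs_div] using (tendsto_const_nhds.div_atTop tendsto_id :
        Tendsto (fun T : ℝ => c / T) atTop (nhds 0)).eventually (Metric.ball_mem_nhds 0 hδ)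
    rw [Metric.tendsto_nhds]
    intro ε hε
    obtain ⟨v, hv, h⟩ := bounds (ε / 3) (by positivity)
    filter_upwards [h, eventually_gt_atTop 0, hsmall (Real.log v) (ε / 3) (by positivity),
      hsmall (Real.log (μ.real A)) (ε / 3) (by positivity)] with T ⟨h1, h2⟩ hT0 h3 h4
    have hlow : 0 < v * Real.exp (T * (-m - 2 * (ε / 3))) := by positivity
    have l1 := Real.log_le_log hlow h1
    have l2 := Real.log_le_log (hlow.trans_le h1) h2
    rw [Real.log_mul hv.ne' (Real.exp_pos _).ne', Real.log_exp] at l1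
    rw [Real.log_mul hVpos.ne' (Real.exp_pos _).ne', Real.log_exp] at l2
    have k1 := div_le_div_of_nonneg_right l1 hT0.le
    have k2 := div_le_div_of_nonneg_right l2 hT0.le
    rw [add_div, mul_div_cancel_left₀ _ hT0.ne'] at k1 k2
    rw [Real.dist_eq, abs_lt, one_div_mul_eq_div]
    rw [abs_lt] at h3 h4
    constructor <;> linarith

/-- Deterministic core of Theorem 1(b): if the unnormalized posterior densities
`ρ T` satisfy `sup_{θ∈Θ} |(1/T) log ρ T θ + I θ| → 0` for a continuous
nonnegative rate function `I` vanishing at an interior point `θ₀`, then the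
posterior probability of a measurable set `S` with `inf_{int S} I = inf_S I`
decays at exponential rate `inf_S I`. -/
theorem stmt9 (d : ℕ)
    (Θ : Set (EuclideanSpace ℝ (Fin d))) (hΘ : IsCompact Θ)
    (hΘint : (interior Θ).Nonempty)
    (I : EuclideanSpace ℝ (Fin d) → ℝ) (hI : Continuous I) (hI0 : ∀ θ, 0 ≤ I θ)
    (θ₀ : EuclideanSpace ℝ (Fin d)) (hθ₀ : θ₀ ∈ interior Θ) (hIθ₀ : I θ₀ = 0)
    (ρ : ℝ → EuclideanSpace ℝ (Fin d) → ℝ)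
    (hρ_pos : ∀ T : ℝ, 0 < T → ∀ θ ∈ Θ, 0 < ρ T θ)
    (hρ_meas : ∀ T : ℝ, 0 < T → Measurable (ρ T))
    (hρ_unif : ∀ ε : ℝ, 0 < ε → ∀ᶠ T : ℝ in atTop,
      ∀ θ ∈ Θ, |(1 / T) * Real.log (ρ T θ) + I θ| < ε)
    (S : Set (EuclideanSpace ℝ (Fin d))) (hSΘ : S ⊆ Θ) (hSm : MeasurableSet S)
    (hSint : (interior S).Nonempty)
    (hSinf : sInf (I '' interior S) = sInf (I '' S)) :
    Tendsto (fun T : ℝ =>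
        -(1 / T) * Real.log ((∫ θ in S, ρ T θ) / (∫ θ in Θ, ρ T θ)))
      atTop (nhds (sInf (I '' S))) := by
  have hΘ0 : sInf (I '' Θ) = 0 :=
    IsLeast.csInf_eq ⟨⟨θ₀, interior_subset hθ₀, hIθ₀⟩, by rintro _ ⟨θ, -, rfl⟩; exact hI0 θ⟩
  have hΘint0 : sInf (I '' interior Θ) = 0 :=
    IsLeast.csInf_eq ⟨⟨θ₀, hθ₀, hIθ₀⟩, by rintro _ ⟨θ, -, rfl⟩; exact hI0 θ⟩
  have hbdd : ∀ A : Set (EuclideanSpace ℝ (Fin d)), BddBelow (I '' A) := fun A =>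
    ⟨0, by rintro _ ⟨θ, -, rfl⟩; exact hI0 θ⟩
  obtain ⟨hSpos, hSlim⟩ := eventually_integral_pos_and_tendsto_log_integral volume hSm
    (measure_ne_top_of_subset hSΘ hΘ.measure_lt_top.ne) hSint hI (hbdd S) hSinf
    (fun T hT θ hθ => hρ_pos T hT θ (hSΘ hθ)) hρ_meas
    (fun ε hε => (hρ_unif ε hε).mono fun T hT θ hθ => hT θ (hSΘ hθ))
  obtain ⟨hΘpos, hΘlim⟩ := eventually_integral_pos_and_tendsto_log_integral volume
    hΘ.measurableSet hΘ.measure_lt_top.ne hΘint hI (hbdd Θ) (hΘint0.trans hΘ0.symm)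
    hρ_pos hρ_meas hρ_unif
  have hlim := hΘlim.sub hSlim
  rw [hΘ0, neg_zero, zero_sub, neg_neg] at hlim
  refine hlim.congr' ?_
  filter_upwards [hSpos, hΘpos] with T hS hT
  rw [Real.log_div hS.ne' hT.ne']
  ring
end

section
/- Let (Ω, F, P) be a probability space with a filtration (F_t)_{t∈ℕ}, and let Δ be a positive integer. For each t ≥ 1, let p_t : Ω → [0,1] be F_{t−1}-measurable and let Y_t : Ω → [0, Δ] be F_t-measurable, and assume that, almost surely, E[Y_t | F_{t−1}] = Δ·p_t and E[(Y_t − Δ·p_t)² | F_{t−1}] = Δ·p_t·(1 − p_t). Then, for P-almost every ω in the event { Σ_{t=1}^∞ p_t = ∞ }, one has ( Σ_{t=1}^T Y_t(ω) ) / ( Δ·Σ_{t=1}^T p_t(ω) ) → 1 as T → ∞. -/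
open Filter MeasureTheory

/-- A weighted form of Kronecker's lemma. -/
theorem tendsto_sum_div_sum_of_tendsto_sum_div {q d : ℕ → ℝ} {c : ℝ} (hq : ∀ n, 0 ≤ q n)
    (hS : Tendsto (fun n => ∑ i ∈ Finset.range n, q i) atTop atTop)
    (hM : Tendsto (fun n => ∑ i ∈ Finset.range n,
      d i / (1 + ∑ j ∈ Finset.range (i + 1), q j)) atTop (nhds c)) :
    Tendsto (fun n => (∑ i ∈ Finset.range n, d i) / ∑ i ∈ Finset.range n, q i)
      atTop (nhds 0) := by
  set S : ℕ → ℝ := fun n => ∑ i ∈ Finset.range n, q i with hSdef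
  set M : ℕ → ℝ := fun n => ∑ i ∈ Finset.range n, d i / (1 + S (i + 1)) with hMdef
  have hS_nonneg : ∀ n, 0 ≤ S n := fun n => Finset.sum_nonneg fun i _ => hq i
  have h_sub : Tendsto (fun n => M n - c) atTop (nhds 0) := by
    simpa using hM.sub_const c
  have h_little : (fun n => ∑ i ∈ Finset.range n, q i * (M i - c)) =o[atTop] S := by
    refine Asymptotics.IsLittleO.sum_range ?_ hq hS
    simpa using (Asymptotics.isBigO_refl q atTop).mul_isLittleO
      ((Asymptotics.isLittleO_one_iff ℝ).2 h_sub)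
  have h_abel : ∀ n, ∑ i ∈ Finset.range n, d i
      = M n + S n * (M n - c) - ∑ i ∈ Finset.range n, q i * (M i - c) := by
    intro n
    induction n with
    | zero => simp [hMdef, hSdef]
    | succ n ih =>
      have hSs : S (n + 1) = S n + q n := Finset.sum_range_succ _ _
      have hMs : M (n + 1) = M n + d n / (1 + S (n + 1)) := Finset.sum_range_succ _ _
      have hd : d n / (1 + S (n + 1)) * (1 + S (n + 1)) = d n :=
        div_mul_cancel₀ _ (by linarith [hS_nonneg (n + 1)])
      rw [Finset.sum_range_succ, Finset.sum_range_succ, ih, ← hd, hMs, hSs]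
      ring
  have h_lim : Tendsto (fun n => M n / S n + (M n - c)
      - (∑ i ∈ Finset.range n, q i * (M i - c)) / S n) atTop (nhds 0) := by
    simpa using ((hM.div_atTop hS).add h_sub).sub h_little.tendsto_div_nhds_zero
  refine h_lim.congr' ?_
  filter_upwards [hS.eventually_gt_atTop 0] with n hn
  have hn' : S n ≠ 0 := ne_of_gt hn
  change _ = _ / S n
  rw [h_abel n]
  field_simp

/-- Bounded measurable factors can be pulled out of a conditional expectation under the
integral. -/
theorem integral_mul_eq_integral_mul_condExp {Ω : Type*} {m m0 : MeasurableSpace Ω}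
    {P : Measure Ω} [IsFiniteMeasure P] (hm : m ≤ m0) {g f : Ω → ℝ}
    (hg : StronglyMeasurable[m] g) (hf : Integrable f P) (c : ℝ) (hc : ∀ ω, |g ω| ≤ c) :
    ∫ ω, g ω * f ω ∂P = ∫ ω, g ω * (P[f|m]) ω ∂P := by
  rw [← integral_condExp hm]
  exact integral_congr_ae
    (condExp_stronglyMeasurable_mul_of_bound hm hg hf c (ae_of_all _ hc))

/-- A strong law for bounded martingale differences whose conditional variances are dominated
by a nonnegative predictable sequence. -/
theorem ae_tendsto_sum_div_sum_of_condExp_sq_le {Ω : Type*} {m0 : MeasurableSpace Ω}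
    {P : Measure Ω} [IsProbabilityMeasure P] {F : Filtration ℕ m0} {q D : ℕ → Ω → ℝ} {K : ℝ}
    (hq : ∀ n ω, 0 ≤ q n ω) (hqm : ∀ n, Measurable[F n] (q n))
    (hDm : ∀ n, Measurable[F (n + 1)] (D n)) (hDb : ∀ n ω, |D n ω| ≤ K)
    (hD0 : ∀ n, P[D n|F n] =ᵐ[P] 0)
    (hD2 : ∀ n, P[fun ω => D n ω ^ 2|F n] ≤ᵐ[P] fun ω => K * q n ω) :
    ∀ᵐ ω ∂P, Tendsto (fun n => ∑ i ∈ Finset.range n, q i ω) atTop atTop →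
      Tendsto (fun n => (∑ i ∈ Finset.range n, D i ω) / ∑ i ∈ Finset.range n, q i ω)
        atTop (nhds 0) := by
  obtain ⟨ω₀⟩ : Nonempty Ω := nonempty_of_isProbabilityMeasure P
  have hK : 0 ≤ K := (abs_nonneg _).trans (hDb 0 ω₀)
  set B : ℕ → Ω → ℝ := fun n ω => 1 + ∑ i ∈ Finset.range n, q i ω with hB
  set M : ℕ → Ω → ℝ := fun n ω => ∑ i ∈ Finset.range n, D i ω / B (i + 1) ω with hM
  have hB1 : ∀ n ω, 1 ≤ B n ω := fun n ω =>
    le_add_of_nonneg_right (Finset.sum_nonneg fun i _ => hq i ω)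
  have hBs : ∀ n ω, B (n + 1) ω = B n ω + q n ω := by
    intro n ω
    simp only [hB, Finset.sum_range_succ]
    ring
  have hMs : ∀ n ω, M (n + 1) ω = M n ω + (B (n + 1) ω)⁻¹ * D n ω := by
    intro n ω
    simp only [hM, Finset.sum_range_succ]
    ring
  have hBm : ∀ n, Measurable[F n] (B (n + 1)) := fun n =>
    measurable_const.add (Finset.measurable_fun_sum _ fun i hi =>
      (hqm i).mono (F.mono (Nat.lt_succ_iff.1 (Finset.mem_range.1 hi))) le_rfl)
  have hMm : ∀ n, Measurable[F n] (M n) := fun n =>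
    Finset.measurable_fun_sum _ fun i hi =>
      ((hDm i).mono (F.mono (Finset.mem_range.1 hi)) le_rfl).div
        ((hBm i).mono (F.mono (Finset.mem_range.1 hi).le) le_rfl)
  have hBinv : ∀ n ω, |(B n ω)⁻¹| ≤ 1 := by
    intro n ω
    rw [abs_of_nonneg (inv_nonneg.2 (zero_le_one.trans (hB1 n ω)))]
    exact inv_le_one_of_one_le₀ (hB1 n ω)
  have hMb : ∀ n ω, |M n ω| ≤ n * K := by
    intro n ω
    induction n with
    | zero => simp [hM]
    | succ n ih =>
      rw [hMs]
      have h1 : |(B (n + 1) ω)⁻¹ * D n ω| ≤ 1 * K := by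
        rw [abs_mul]
        exact mul_le_mul (hBinv _ ω) (hDb n ω) (abs_nonneg _) zero_le_one
      have h2 := abs_add_le (M n ω) ((B (n + 1) ω)⁻¹ * D n ω)
      push_cast
      linarith
  have h_int : ∀ {f : Ω → ℝ}, Measurable f → ∀ c : ℝ, (∀ ω, |f ω| ≤ c) → Integrable f P :=
    fun hf c hc => Integrable.of_bound hf.aestronglyMeasurable c (ae_of_all _ hc)
  have hDm' : ∀ n, Measurable (D n) := fun n => (hDm n).mono (F.le _) le_rfl
  have hMm' : ∀ n, Measurable (M n) := fun n => (hMm n).mono (F.le _) le_rfl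
  have hBm' : ∀ n, Measurable (B n) := by
    intro n
    exact measurable_const.add (Finset.measurable_fun_sum _ fun i _ =>
      (hqm i).mono (F.le _) le_rfl)
  have hDi : ∀ n, Integrable (D n) P := fun n => h_int (hDm' n) K (hDb n)
  have hMi : ∀ n, Integrable (M n) P := fun n => h_int (hMm' n) _ (hMb n)
  have hD2b : ∀ n ω, |D n ω ^ 2| ≤ K ^ 2 := fun n ω => by
    rw [abs_pow]
    exact pow_le_pow_left₀ (abs_nonneg _) (hDb n ω) 2
  have hD2i : ∀ n, Integrable (fun ω => D n ω ^ 2) P := fun n =>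
    h_int ((hDm' n).pow_const 2) _ (hD2b n)
  have hM2i : ∀ n, Integrable (fun ω => M n ω ^ 2) P := fun n =>
    h_int ((hMm' n).pow_const 2) ((n * K) ^ 2) fun ω => by
      rw [abs_pow]
      exact pow_le_pow_left₀ (abs_nonneg _) (hMb n ω) 2
  have hBi : ∀ n, Integrable (fun ω => (B n ω)⁻¹) P := fun n =>
    h_int (hBm' n).inv 1 (hBinv n)
  have h_mart : Martingale M F P := by
    refine martingale_of_condExp_sub_eq_zero_nat (fun n => (hMm n).stronglyMeasurable) hMi ?_
    intro n
    have h_eq : M (n + 1) - M n = (fun ω => (B (n + 1) ω)⁻¹) * D n := by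
      ext ω
      simp [hMs]
    rw [h_eq]
    filter_upwards [condExp_stronglyMeasurable_mul_of_bound (F.le n)
      (hBm n).inv.stronglyMeasurable (hDi n) 1 (ae_of_all _ (hBinv (n + 1))), hD0 n]
      with ω h1 h2
    refine h1.trans ?_
    simp [h2]
  have h_cross : ∀ n, ∫ ω, (2 * M n ω * (B (n + 1) ω)⁻¹) * D n ω ∂P = 0 := by
    intro n
    rw [integral_mul_eq_integral_mul_condExp (F.le n)
      (g := fun ω => 2 * M n ω * (B (n + 1) ω)⁻¹)
      (((hMm n).const_mul 2).mul (hBm n).inv).stronglyMeasurable (hDi n) (2 * (n * K) * 1)]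
    · refine integral_eq_zero_of_ae ?_
      filter_upwards [hD0 n] with ω h
      simp [h]
    · intro ω
      rw [abs_mul, abs_mul, abs_two]
      exact mul_le_mul (mul_le_mul_of_nonneg_left (hMb n ω) zero_le_two) (hBinv _ ω)
        (abs_nonneg _) (by positivity)
  have hB2b : ∀ n ω, |(B n ω)⁻¹ ^ 2| ≤ 1 := fun n ω => by
    rw [abs_pow]
    exact pow_le_one₀ (abs_nonneg _) (hBinv n ω)
  have h_sq : ∀ n, ∫ ω, (B (n + 1) ω)⁻¹ ^ 2 * D n ω ^ 2 ∂P
      ≤ K * ∫ ω, (B n ω)⁻¹ ∂P - K * ∫ ω, (B (n + 1) ω)⁻¹ ∂P := by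
    intro n
    rw [integral_mul_eq_integral_mul_condExp (F.le n)
      (g := fun ω => (B (n + 1) ω)⁻¹ ^ 2)
      ((hBm n).inv.pow_const 2).stronglyMeasurable (hD2i n) 1 (hB2b (n + 1)),
      ← integral_const_mul, ← integral_const_mul,
      ← integral_sub ((hBi n).const_mul K) ((hBi (n + 1)).const_mul K)]
    refine integral_mono_ae ?_ (((hBi n).const_mul K).sub ((hBi (n + 1)).const_mul K)) ?_
    · exact integrable_condExp.bdd_mul ((hBm' (n + 1)).inv.pow_const 2).aestronglyMeasurable
        (ae_of_all _ (hB2b (n + 1)))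
    · filter_upwards [hD2 n] with ω h
      have h1 : 0 < B n ω := zero_lt_one.trans_le (hB1 n ω)
      have h2 : 0 < B (n + 1) ω := zero_lt_one.trans_le (hB1 (n + 1) ω)
      have h3 : B n ω ≤ B (n + 1) ω := by linarith [hBs n ω, hq n ω]
      have h4 : (B (n + 1) ω)⁻¹ ≤ (B n ω)⁻¹ := inv_anti₀ h1 h3
      calc (B (n + 1) ω)⁻¹ ^ 2 * (P[fun ω => D n ω ^ 2|F n]) ω
          ≤ (B (n + 1) ω)⁻¹ ^ 2 * (K * q n ω) := by gcongr
        _ = K * q n ω * (B (n + 1) ω)⁻¹ * (B (n + 1) ω)⁻¹ := by ring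
        _ ≤ K * q n ω * (B (n + 1) ω)⁻¹ * (B n ω)⁻¹ := by
          have := hq n ω
          gcongr
        _ = K * (B n ω)⁻¹ - K * (B (n + 1) ω)⁻¹ := by
          have : q n ω = B (n + 1) ω - B n ω := by linarith [hBs n ω]
          rw [this]
          field_simp
  have h_bound : ∀ n, ∫ ω, M n ω ^ 2 ∂P ≤ K - K * ∫ ω, (B n ω)⁻¹ ∂P := by
    intro n
    induction n with
    | zero => simp [hM, hB]
    | succ n ih =>
      have h_exp : ∀ ω, M (n + 1) ω ^ 2 = M n ω ^ 2
          + (2 * M n ω * (B (n + 1) ω)⁻¹) * D n ω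
          + (B (n + 1) ω)⁻¹ ^ 2 * D n ω ^ 2 := by
        intro ω
        rw [hMs]
        ring
      have i1 : Integrable (fun ω => (2 * M n ω * (B (n + 1) ω)⁻¹) * D n ω) P := by
        refine h_int ((((hMm' n).const_mul 2).mul (hBm' (n + 1)).inv).mul (hDm' n))
          (2 * (n * K) * 1 * K) fun ω => ?_
        rw [abs_mul, abs_mul, abs_mul, abs_two]
        have := hMb n ω
        have := hBinv (n + 1) ω
        have := hDb n ω
        gcongr
      have i2 : Integrable (fun ω => (B (n + 1) ω)⁻¹ ^ 2 * D n ω ^ 2) P :=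
        (hD2i n).bdd_mul ((hBm' (n + 1)).inv.pow_const 2).aestronglyMeasurable
          (ae_of_all _ (hB2b (n + 1)))
      simp_rw [h_exp]
      rw [integral_add (f := fun ω => M n ω ^ 2
        + (2 * M n ω * (B (n + 1) ω)⁻¹) * D n ω) ((hM2i n).add i1) i2,
        integral_add (hM2i n) i1, h_cross n]
      linarith [h_sq n]
  have h_norm : ∀ n, eLpNorm (M n) 1 P ≤ ((1 + K).toNNReal : NNReal) := by
    intro n
    rw [eLpNorm_one_eq_lintegral_enorm, ← ofReal_integral_norm_eq_lintegral_enorm (hMi n)]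
    refine ENNReal.ofReal_le_ofReal ?_
    have h1 : ∫ ω, ‖M n ω‖ ∂P ≤ ∫ ω, (1 + M n ω ^ 2) ∂P := by
      refine integral_mono (hMi n).norm ((integrable_const 1).add (hM2i n)) fun ω => ?_
      have h := sq_abs (M n ω)
      simp only [Real.norm_eq_abs]
      nlinarith [sq_nonneg (|M n ω| - 1), sq_nonneg (M n ω)]
    have h2 : 0 ≤ ∫ ω, (B n ω)⁻¹ ∂P :=
      integral_nonneg fun ω => inv_nonneg.2 (zero_le_one.trans (hB1 n ω))
    rw [integral_add (integrable_const 1) (hM2i n)] at h1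
    simp only [integral_const, probReal_univ, smul_eq_mul, mul_one] at h1
    linarith [h_bound n, mul_nonneg hK h2]
  filter_upwards [h_mart.submartingale.exists_ae_tendsto_of_bdd h_norm] with ω ⟨c, hc⟩ hS
  exact tendsto_sum_div_sum_of_tendsto_sum_div (fun n => hq n ω) hS hc

/-- Lemma EC.3 (conditional second Borel–Cantelli): if, conditionally on the past,
`Y t` has the mean and variance of a `Binomial(Δ, p t)` random variable with
predictable success probability `p t`, then on the event `Σ p_t = ∞` one has
`(Σ_{t≤T} Y_t) / (Δ Σ_{t≤T} p_t) → 1` almost surely. -/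
theorem stmt12 (Ω : Type*) [m0 : MeasurableSpace Ω] (P : Measure Ω)
    [IsProbabilityMeasure P]
    (F : Filtration ℕ m0) (Δ : ℕ) (hΔ : 0 < Δ)
    (p : ℕ → Ω → ℝ) (Y : ℕ → Ω → ℝ)
    (hp_range : ∀ t, 1 ≤ t → ∀ ω, p t ω ∈ Set.Icc (0 : ℝ) 1)
    (hp_meas : ∀ t, 1 ≤ t → Measurable[F (t - 1)] (p t))
    (hY_range : ∀ t, 1 ≤ t → ∀ ω, Y t ω ∈ Set.Icc (0 : ℝ) (Δ : ℝ))
    (hY_meas : ∀ t, 1 ≤ t → Measurable[F t] (Y t))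
    (hmean : ∀ t, 1 ≤ t →
      P[Y t|F (t - 1)] =ᵐ[P] fun ω => (Δ : ℝ) * p t ω)
    (hvar : ∀ t, 1 ≤ t →
      P[fun ω => (Y t ω - (Δ : ℝ) * p t ω) ^ 2|F (t - 1)] =ᵐ[P]
        fun ω => (Δ : ℝ) * p t ω * (1 - p t ω)) :
    ∀ᵐ ω ∂P,
      Tendsto (fun T : ℕ => ∑ t ∈ Finset.Icc 1 T, p t ω) atTop atTop →
      Tendsto (fun T : ℕ =>
          (∑ t ∈ Finset.Icc 1 T, Y t ω) / ((Δ : ℝ) * ∑ t ∈ Finset.Icc 1 T, p t ω))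
        atTop (nhds 1) := by
  have hIcc : ∀ (f : ℕ → ℝ) (T : ℕ),
      ∑ t ∈ Finset.Icc 1 T, f t = ∑ i ∈ Finset.range T, f (i + 1) := by
    intro f T
    rw [Finset.range_eq_Ico, Finset.sum_Ico_add' f 0 T 1]
    rfl
  have hΔ' : (0 : ℝ) < Δ := Nat.cast_pos.2 hΔ
  have hpm : ∀ n, Measurable[F n] (p (n + 1)) := fun n => hp_meas (n + 1) (by omega)
  have hYm : ∀ n, Measurable[F (n + 1)] (Y (n + 1)) := fun n => hY_meas (n + 1) (by omega)
  have hp0 : ∀ n ω, 0 ≤ p (n + 1) ω := fun n ω => (hp_range (n + 1) (by omega) ω).1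
  have hp1 : ∀ n ω, p (n + 1) ω ≤ 1 := fun n ω => (hp_range (n + 1) (by omega) ω).2
  have hY0 : ∀ n ω, 0 ≤ Y (n + 1) ω := fun n ω => (hY_range (n + 1) (by omega) ω).1
  have hY1 : ∀ n ω, Y (n + 1) ω ≤ Δ := fun n ω => (hY_range (n + 1) (by omega) ω).2
  have h_mean : ∀ n, P[fun ω => Y (n + 1) ω - Δ * p (n + 1) ω|F n] =ᵐ[P] 0 := by
    intro n
    have hYi : Integrable (Y (n + 1)) P :=
      Integrable.of_bound ((hYm n).mono (F.le _) le_rfl).aestronglyMeasurable Δ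
        (ae_of_all _ fun ω => by
          rw [Real.norm_eq_abs, abs_of_nonneg (hY0 n ω)]
          exact hY1 n ω)
    have hpi : Integrable (fun ω => (Δ : ℝ) * p (n + 1) ω) P :=
      (Integrable.of_bound ((hpm n).mono (F.le _) le_rfl).aestronglyMeasurable 1
        (ae_of_all _ fun ω => by
          rw [Real.norm_eq_abs, abs_of_nonneg (hp0 n ω)]
          exact hp1 n ω)).const_mul _
    have h_self : P[fun ω => (Δ : ℝ) * p (n + 1) ω|F n] = fun ω => (Δ : ℝ) * p (n + 1) ω :=
      condExp_of_stronglyMeasurable (F.le n) ((hpm n).const_mul _).stronglyMeasurable hpi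
    filter_upwards [condExp_sub hYi hpi (F n), hmean (n + 1) (by omega)] with ω h1 h2
    refine h1.trans ?_
    rw [Nat.add_sub_cancel] at h2
    rw [Pi.sub_apply, h2, h_self]
    simp
  have h_law := ae_tendsto_sum_div_sum_of_condExp_sq_le (P := P) (F := F) (K := (Δ : ℝ))
    (q := fun n => p (n + 1)) (D := fun n ω => Y (n + 1) ω - Δ * p (n + 1) ω)
    hp0 hpm
    (fun n => (hYm n).sub (((hpm n).mono (F.mono n.le_succ) le_rfl).const_mul _))
    (fun n ω => abs_le.2 ⟨by nlinarith [hp1 n ω, hY0 n ω], by nlinarith [hp0 n ω, hY1 n ω]⟩)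
    h_mean
    (fun n => by
      filter_upwards [hvar (n + 1) (by omega)] with ω h
      rw [Nat.add_sub_cancel] at h
      rw [h]
      nlinarith [mul_nonneg hΔ'.le (mul_nonneg (hp0 n ω) (hp0 n ω))])
  filter_upwards [h_law] with ω hω hS
  simp only [hIcc (fun t => p t ω), hIcc (fun t => Y t ω)] at hS ⊢
  have h_lim := ((hω hS).div_const (Δ : ℝ)).const_add 1
  rw [zero_div, add_zero] at h_lim
  refine h_lim.congr' ?_
  filter_upwards [hS.eventually_gt_atTop 0] with n hn
  rw [Finset.sum_sub_distrib, ← Finset.mul_sum]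
  have hn' := hn.ne'
  field_simp
  ring
end

section
/- Let (Ω, F, P) be a probability space and for each n ≥ 1 let Y_n : Ω → ℝ be a random variable whose law under P is the Gaussian measure on ℝ with mean μ_n and variance λ_n² (no independence or joint-distribution assumption is made beyond the marginals). If limsup_{n→∞} n·λ_n² < ∞ and μ_n → μ₀ as n → ∞, then Y_n → μ₀ P-almost surely. -/
open Filter MeasureTheory ProbabilityTheory
open scoped NNReal ENNReal

theorem hasSubgaussianMGF_sub_of_map_eq_gaussianReal {Ω : Type*} [MeasurableSpace Ω]
    {P : Measure Ω} {X : Ω → ℝ} {m : ℝ} {v : ℝ≥0}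
    (hX : Measure.map X P = gaussianReal m v) :
    HasSubgaussianMGF (fun ω => X ω - m) v P := by
  have hXm : AEMeasurable X P := by
    refine AEMeasurable.of_map_ne_zero ?_
    rw [hX]
    exact IsProbabilityMeasure.ne_zero _
  have hlaw : HasLaw (fun ω => X ω - m) (gaussianReal 0 v) P := by
    simpa using gaussianReal_sub_const ⟨hXm, hX⟩ m
  have hid : HasSubgaussianMGF id v (gaussianReal 0 v) :=
    { integrable_exp_mul := fun t => integrable_exp_mul_gaussianReal t
      mgf_le := fun t => by simp [mgf_id_gaussianReal] }
  rw [← hlaw.map_eq] at hid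
  exact hid.of_map hlaw.aemeasurable

theorem ProbabilityTheory.HasSubgaussianMGF.mono {Ω : Type*} [MeasurableSpace Ω] {P : Measure Ω} {X : Ω → ℝ}
    {c d : ℝ≥0} (h : HasSubgaussianMGF X c P) (hcd : c ≤ d) : HasSubgaussianMGF X d P where
  integrable_exp_mul := h.integrable_exp_mul
  mgf_le t := (h.mgf_le t).trans (by gcongr)

theorem ProbabilityTheory.HasSubgaussianMGF.measure_abs_ge_le {Ω : Type*} [MeasurableSpace Ω] {P : Measure Ω}
    [IsFiniteMeasure P] {X : Ω → ℝ} {c : ℝ≥0} (h : HasSubgaussianMGF X c P)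
    {ε : ℝ} (hε : 0 ≤ ε) :
    P.real {ω | ε ≤ |X ω|} ≤ 2 * Real.exp (-ε ^ 2 / (2 * c)) := by
  have hunion : {ω | ε ≤ |X ω|} = {ω | ε ≤ X ω} ∪ {ω | ε ≤ (-X) ω} := by
    ext ω
    simp [le_abs]
  rw [hunion, two_mul]
  exact (measureReal_union_le _ _).trans (add_le_add (h.measure_ge_le hε) (h.neg.measure_ge_le hε))

/-- Sub-Gaussian variables whose variance proxies are `O(1 / n)` converge to `0` almost surely,
whatever their joint distribution. -/
theorem ae_tendsto_zero_of_hasSubgaussianMGF {Ω : Type*} [MeasurableSpace Ω] {P : Measure Ω}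
    [IsFiniteMeasure P] {X : ℕ → Ω → ℝ} {c : ℕ → ℝ≥0}
    (hX : ∀ n, HasSubgaussianMGF (X n) (c n) P)
    {C : ℝ≥0} (hC : 0 < C) (hc : ∀ᶠ n : ℕ in atTop, n * c n ≤ C) :
    ∀ᵐ ω ∂P, Tendsto (fun n => X n ω) atTop (nhds 0) := by
  have hsmall (ε : ℝ) (hε : 0 < ε) : ∀ᵐ ω ∂P, ∀ᶠ n in atTop, |X n ω| < ε := by
    have hgeom : Summable fun n : ℕ => 2 * Real.exp (n * (-ε ^ 2 / (2 * C))) :=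
      (Real.summable_exp_nat_mul_iff.2
        (div_neg_of_neg_of_pos (by nlinarith) (by positivity))).mul_left 2
    have hsum : Summable fun n => P.real {ω | ε ≤ |X n ω|} := by
      refine hgeom.of_norm_bounded_eventually_nat ?_
      filter_upwards [hc, eventually_gt_atTop 0] with n hn hn0
      have hn0' : (0 : ℝ≥0) < n := by exact_mod_cast hn0
      have hcn : c n ≤ C / n := by rwa [le_div_iff₀' hn0']
      rw [Real.norm_of_nonneg measureReal_nonneg]
      refine (((hX n).mono hcn).measure_abs_ge_le hε.le).trans_eq ?_
      have : (n : ℝ) ≠ 0 := by positivity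
      have : (C : ℝ) ≠ 0 := by positivity
      push_cast
      congr 2
      field_simp
    have hfin : ∑' n, P {ω | ε ≤ |X n ω|} ≠ ∞ := by
      simpa using hsum.tsum_ofReal_ne_top
    filter_upwards [ae_eventually_notMem hfin] with ω hω
    simpa using hω
  have hall : ∀ᵐ ω ∂P, ∀ k : ℕ, ∀ᶠ n in atTop, |X n ω| < 1 / ((k : ℝ) + 1) :=
    ae_all_iff.2 fun k => hsmall _ (by positivity)
  filter_upwards [hall] with ω hω
  rw [Metric.tendsto_nhds]
  intro ε hε
  obtain ⟨k, hk⟩ := exists_nat_one_div_lt hε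
  filter_upwards [hω k] with n hn
  simpa using hn.trans hk

/-- Lemma EC.5: if `Y n` has the Gaussian law `N(μ n, v n)` under `P`, with
`limsup n · v n < ∞` and `μ n → μ₀`, then `Y n → μ₀` almost surely. -/
theorem stmt14 (Ω : Type*) [MeasurableSpace Ω] (P : Measure Ω)
    [IsProbabilityMeasure P]
    (Y : ℕ → Ω → ℝ) (μ : ℕ → ℝ) (v : ℕ → ℝ≥0) (μ₀ : ℝ)
    (hlaw : ∀ n, Measure.map (Y n) P = gaussianReal (μ n) (v n))
    (hv : atTop.limsup (fun n : ℕ => (n : ℝ≥0∞) * (v n : ℝ≥0∞)) < ⊤)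
    (hμ : Tendsto μ atTop (nhds μ₀)) :
    ∀ᵐ ω ∂P, Tendsto (fun n => Y n ω) atTop (nhds μ₀) := by
  obtain ⟨C, hC, -⟩ := ENNReal.lt_iff_exists_nnreal_btwn.1 hv
  have hbound : ∀ᶠ n : ℕ in atTop, n * v n ≤ C := by
    filter_upwards [eventually_lt_of_limsup_lt hC] with n hn
    exact_mod_cast hn.le
  have hCpos : 0 < C := by exact_mod_cast pos_of_gt hC
  filter_upwards [ae_tendsto_zero_of_hasSubgaussianMGF
    (fun n => hasSubgaussianMGF_sub_of_map_eq_gaussianReal (hlaw n)) hCpos hbound] with ω hω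
  simpa using hω.add hμ
end
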